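/- arXiv:1407.3530 — 2 statements merged into one kernel-verified Lean document; each statement's English description precedes it below -/
import Mathlib

section
/- Let g ≥ 2, let V be a 2g-dimensional 𝔽₂-vector space with a nondegenerate alternating bilinear form ⟨·,·⟩, and fix a nonzero δ ∈ V with orthogonal complement δ^⊥ = {μ ∈ V : ⟨δ,μ⟩ = 0}. Then the number of 2-dimensional subspaces W ⊆ V with W ⊆ δ^⊥, δ ∉ W, and W isotropic (⟨a,b⟩ = 0 for all a, b ∈ W) equals (2^{2g−1} − 2)(2^{2g−2} − 4)/6. -/
section

variable {V : Type*} [AddCommGroup V] [Module (ZMod 2) V]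

theorem finrank_span_pair_zmod_two {a b : V} (ha : a ≠ 0) (hb : b ≠ 0) (hab : a ≠ b) :
    Module.finrank (ZMod 2) (Submodule.span (ZMod 2) {a, b}) = 2 := by
  have hli : LinearIndependent (ZMod 2) ![a, b] := by
    rw [LinearIndependent.pair_iff]
    intro s t h
    have h01 : ∀ x : ZMod 2, x = 0 ∨ x = 1 := by decide
    rcases h01 s with rfl | rfl <;> rcases h01 t with rfl | rfl <;> simp_all
    exact hab (by rw [eq_neg_of_add_eq_zero_left h, ZModModule.neg_eq_self])
  rw [← Matrix.range_cons_cons_empty a b ![]]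
  exact finrank_span_eq_card hli

theorem mem_span_pair_zmod_two {a b x : V} (h : x ∈ Submodule.span (ZMod 2) {a, b}) :
    x = 0 ∨ x = a ∨ x = b ∨ x = a + b := by
  obtain ⟨s, t, rfl⟩ := Submodule.mem_span_pair.1 h
  have h01 : ∀ x : ZMod 2, x = 0 ∨ x = 1 := by decide
  rcases h01 s with rfl | rfl <;> rcases h01 t with rfl | rfl <;> simp

open Classical in
/-- A linear functional that does not vanish on a finite submodule vanishes on exactly half
of it. -/
theorem two_mul_card_filter_eq_zero [Fintype V] (U : Submodule (ZMod 2) V)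
    (f : V →ₗ[ZMod 2] ZMod 2) {u : V} (hu : u ∈ U) (hfu : f u ≠ 0) :
    2 * (Finset.univ.filter fun v => v ∈ U ∧ f v = 0).card =
      (Finset.univ.filter fun v => v ∈ U).card := by
  have h1 : ∀ x : ZMod 2, x ≠ 0 → x = 1 := by decide
  have h11 : (1 : ZMod 2) + 1 = 0 := by decide
  have hsplit := Finset.card_filter_add_card_filter_not
    (s := Finset.univ.filter fun v => v ∈ U) (fun v => f v = 0)
  rw [Finset.filter_filter, Finset.filter_filter] at hsplit
  have hbij : (Finset.univ.filter fun v => v ∈ U ∧ f v = 0).card =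
      (Finset.univ.filter fun v => v ∈ U ∧ ¬ f v = 0).card := by
    refine Finset.card_nbij' (· + u) (· + u) ?_ ?_ ?_ ?_
    · intro v hv
      simp only [Finset.coe_filter, Finset.mem_univ, true_and, Set.mem_ofPred_eq] at hv ⊢
      exact ⟨U.add_mem hv.1 hu, by simpa [hv.2] using hfu⟩
    · intro v hv
      simp only [Finset.coe_filter, Finset.mem_univ, true_and, Set.mem_ofPred_eq] at hv ⊢
      exact ⟨U.add_mem hv.1 hu, by rw [map_add, h1 _ hv.2, h1 _ hfu, h11]⟩
    · intro v _
      simp [add_assoc, ZModModule.add_self]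
    · intro v _
      simp [add_assoc, ZModModule.add_self]
  omega

open Classical in
theorem card_ker_of_ne_zero [Fintype V] (f : V →ₗ[ZMod 2] ZMod 2) {u : V} (hfu : f u ≠ 0) :
    2 * (Finset.univ.filter fun v => f v = 0).card = Fintype.card V := by
  simpa using two_mul_card_filter_eq_zero ⊤ f (Submodule.mem_top (x := u)) hfu

theorem exists_orthogonal_not_orthogonal (B : V →ₗ[ZMod 2] V →ₗ[ZMod 2] ZMod 2)
    (hnd : ∀ v : V, (∀ w : V, B v w = 0) → v = 0) {δ a : V} (hδ : δ ≠ 0)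
    (ha : a ≠ 0) (haδ : a ≠ δ) : ∃ u, B δ u = 0 ∧ B a u ≠ 0 := by
  have h1 : ∀ x : ZMod 2, x = 0 ∨ x = 1 := by decide
  by_contra! h
  obtain ⟨w, hw⟩ : ∃ w, B δ w ≠ 0 := by
    by_contra! hw
    exact hδ (hnd δ hw)
  have hw1 := (h1 _).resolve_left hw
  have hc : a - B a w • δ = 0 := by
    refine hnd _ fun v => ?_
    have hv := h (v - B δ v • w) (by simp [hw1])
    simp only [map_sub, map_smul, smul_eq_mul, LinearMap.sub_apply, LinearMap.smul_apply] at hv ⊢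
    rw [mul_comm]; exact hv
  rcases h1 (B a w) with h0 | h0 <;> rw [h0] at hc
  · exact ha (by simpa using hc)
  · exact haδ (by simpa [sub_eq_zero] using hc)

open Classical in
/-- The ordered pairs `(a, b)` of orthogonal vectors in `δ^⊥` with `a, b, δ` linearly
independent. -/
noncomputable def orthogonalPairs [Fintype V] (B : V →ₗ[ZMod 2] V →ₗ[ZMod 2] ZMod 2) (δ : V) :
    Finset (Σ _ : V, V) :=
  ((Finset.univ.filter fun a => B δ a = 0) \ {0, δ}).sigma fun a =>
    (Finset.univ.filter fun b => B δ b = 0 ∧ B a b = 0) \ {0, δ, a, a + δ}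

theorem mem_orthogonalPairs [Fintype V] {B : V →ₗ[ZMod 2] V →ₗ[ZMod 2] ZMod 2} {δ a b : V} :
    ⟨a, b⟩ ∈ orthogonalPairs B δ ↔ (B δ a = 0 ∧ a ≠ 0 ∧ a ≠ δ) ∧ (B δ b = 0 ∧ B a b = 0) ∧
      b ≠ 0 ∧ b ≠ δ ∧ b ≠ a ∧ b ≠ a + δ := by
  simp [orthogonalPairs]

theorem card_orthogonalPairs [Fintype V] {g : ℕ} (hg : 2 ≤ g)
    (hcard : Fintype.card V = 2 ^ (2 * g)) (B : V →ₗ[ZMod 2] V →ₗ[ZMod 2] ZMod 2)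
    (halt : ∀ v : V, B v v = 0) (hnd : ∀ v : V, (∀ w : V, B v w = 0) → v = 0)
    {δ : V} (hδ : δ ≠ 0) :
    (orthogonalPairs B δ).card = (2 ^ (2 * g - 1) - 2) * (2 ^ (2 * g - 2) - 4) := by
  classical
  have hk : 2 ^ (2 * g) = 2 * 2 ^ (2 * g - 1) ∧ 2 ^ (2 * g - 1) = 2 * 2 ^ (2 * g - 2) := by
    constructor <;> rw [← pow_succ'] <;> congr 1 <;> omega
  obtain ⟨w, hw⟩ : ∃ w, B δ w ≠ 0 := by
    by_contra! hw
    exact hδ (hnd δ hw)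
  have hker := card_ker_of_ne_zero (B δ) hw
  unfold orthogonalPairs
  rw [Finset.card_sigma, Finset.sum_const_nat (m := 2 ^ (2 * g - 2) - 4)]
  · rw [Finset.card_sdiff_of_subset, Finset.card_pair hδ.symm]
    · congr 2
      omega
    · intro x hx
      simp only [Finset.mem_insert, Finset.mem_singleton] at hx
      rcases hx with rfl | rfl <;> simp [halt]
  · intro a ha
    simp only [Finset.mem_sdiff, Finset.mem_filter, Finset.mem_univ, true_and,
      Finset.mem_insert, Finset.mem_singleton, not_or] at ha
    obtain ⟨hδa, ha0, haδ⟩ := ha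
    have haδ' : B a δ = 0 := by
      have h := halt (a + δ)
      simpa [halt, hδa] using h
    obtain ⟨u, hu, hau⟩ := exists_orthogonal_not_orthogonal B hnd hδ ha0 haδ
    have h2 := two_mul_card_filter_eq_zero (LinearMap.ker (B δ)) (B a)
      (LinearMap.mem_ker.2 hu) hau
    simp only [LinearMap.mem_ker] at h2
    have hne : a + δ ≠ 0 := fun h =>
      haδ (by rw [eq_neg_of_add_eq_zero_left h, ZModModule.neg_eq_self])
    have h4 : ({0, δ, a, a + δ} : Finset V).card = 4 := by
      rw [Finset.card_insert_of_notMem, Finset.card_insert_of_notMem,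
        Finset.card_insert_of_notMem, Finset.card_singleton]
      · simpa using hδ
      · simp [Ne.symm haδ, ha0]
      · simp [hδ.symm, hne.symm, Ne.symm ha0]
    rw [Finset.card_sdiff_of_subset, h4]
    · congr 1
      omega
    · intro x hx
      simp only [Finset.mem_insert, Finset.mem_singleton] at hx
      rcases hx with rfl | rfl | rfl | rfl <;> simp [halt, hδa, haδ']

end

/-- In a `2g`-dimensional `𝔽₂`-vector space with a nondegenerate alternating
bilinear form and a fixed nonzero `δ`, the number of isotropic 2-dimensional subspaces
`W ⊆ δ^⊥` with `δ ∉ W` equals `(2^{2g−1} − 2)(2^{2g−2} − 4)/6`. -/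
theorem count_isotropic_planes_in_perp_avoiding_delta
    (g : ℕ) (hg : 2 ≤ g) (V : Type*) [AddCommGroup V] [Module (ZMod 2) V]
    [FiniteDimensional (ZMod 2) V] (hdim : Module.finrank (ZMod 2) V = 2 * g)
    (B : V →ₗ[ZMod 2] V →ₗ[ZMod 2] ZMod 2)
    (halt : ∀ v : V, B v v = 0)
    (hnd : ∀ v : V, (∀ w : V, B v w = 0) → v = 0)
    (δ : V) (hδ : δ ≠ 0) :
    Nat.card {W : Submodule (ZMod 2) V //
        Module.finrank (ZMod 2) W = 2 ∧ (∀ μ ∈ W, B δ μ = 0) ∧ δ ∉ W ∧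
          ∀ a ∈ W, ∀ b ∈ W, B a b = 0} =
      (2 ^ (2 * g - 1) - 2) * (2 ^ (2 * g - 2) - 4) / 6 := by
  classical
  have : Finite V := Module.finite_of_finite (ZMod 2)
  have : Fintype V := Fintype.ofFinite V
  have hcard : Fintype.card V = 2 ^ (2 * g) := by
    rw [Module.card_eq_pow_finrank (K := ZMod 2), hdim, ZMod.card]
  have : Fintype (Submodule (ZMod 2) V) := Fintype.ofFinite _
  rw [← card_orthogonalPairs hg hcard B halt hnd hδ, Nat.card_eq_fintype_card,
    Fintype.card_subtype]
  symm
  apply Nat.div_eq_of_eq_mul_left (by norm_num)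
  have hsymm : ∀ a b, B a b = 0 → B b a = 0 := by
    intro a b h
    have h' := halt (a + b)
    simpa [halt, h] using h'
  refine (Finset.card_eq_sum_card_fiberwise
    (f := fun p : Σ _ : V, V => Submodule.span (ZMod 2) {p.1, p.2}) ?_).trans
    (Finset.sum_const_nat ?_)
  · rintro ⟨a, b⟩ hp
    obtain ⟨⟨hδa, ha, haδ⟩, ⟨hδb, hab⟩, hb, hbδ, hba, hbaδ⟩ := mem_orthogonalPairs.1 hp
    simp only [Finset.coe_filter, Finset.mem_univ, true_and, Set.mem_ofPred_eq]
    refine ⟨finrank_span_pair_zmod_two ha hb hba.symm, fun x hx => ?_, fun hx => ?_,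
      fun x hx y hy => ?_⟩
    · rcases mem_span_pair_zmod_two hx with rfl | rfl | rfl | rfl <;> simp [*]
    · rcases mem_span_pair_zmod_two hx with h | h | h | h
      · exact hδ h
      · exact haδ h.symm
      · exact hbδ h.symm
      · exact hbaδ (by rw [h, ← add_assoc, ZModModule.add_self, zero_add])
    · have hba' := hsymm _ _ hab
      rcases mem_span_pair_zmod_two hx with rfl | rfl | rfl | rfl <;>
      rcases mem_span_pair_zmod_two hy with rfl | rfl | rfl | rfl <;> simp [*]
  · intro W hW
    simp only [Finset.mem_filter, Finset.mem_univ, true_and] at hW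
    obtain ⟨hW2, hWδ, hδW, hWiso⟩ := hW
    have hWcard : (Finset.univ.filter fun v => v ∈ W).card = 4 := by
      rw [← Fintype.card_subtype]
      have h := Module.card_eq_pow_finrank (K := ZMod 2) (V := W)
      rw [hW2, ZMod.card] at h
      norm_num at h
      convert h
    have hoff : ((Finset.univ.filter fun v => v ∈ W).erase 0).offDiag.card = 6 := by
      rw [Finset.offDiag_card, Finset.card_erase_of_mem (by simp), hWcard]
    rw [← hoff]
    refine Finset.card_nbij' (fun p => (p.1, p.2)) (fun p => ⟨p.1, p.2⟩) ?_ ?_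
      (fun _ _ => rfl) (fun _ _ => rfl)
    · rintro ⟨a, b⟩ hp
      obtain ⟨hpair, rfl⟩ := Finset.mem_filter.1 (Finset.mem_coe.1 hp)
      obtain ⟨⟨-, ha, -⟩, -, hb, -, hba, -⟩ := mem_orthogonalPairs.1 hpair
      have ha' : a ∈ Submodule.span (ZMod 2) {a, b} := Submodule.subset_span (by simp)
      have hb' : b ∈ Submodule.span (ZMod 2) {a, b} := Submodule.subset_span (by simp)
      simpa [ha, hb, ha', hb'] using hba.symm
    · rintro ⟨a, b⟩ hp
      simp only [Finset.mem_coe, Finset.mem_offDiag, Finset.mem_erase, Finset.mem_filter,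
        Finset.mem_univ, true_and] at hp
      obtain ⟨⟨ha, haW⟩, ⟨hb, hbW⟩, hab⟩ := hp
      refine Finset.mem_filter.2 ⟨mem_orthogonalPairs.2 ⟨⟨hWδ a haW, ha, ?_⟩,
        ⟨hWδ b hbW, hWiso a haW b hbW⟩, hb, ?_, hab.symm, ?_⟩, ?_⟩
      · rintro rfl; exact hδW haW
      · rintro rfl; exact hδW hbW
      · intro h
        exact hδW ((W.add_mem_iff_right haW).1 (h ▸ hbW))
      · refine Submodule.eq_of_le_of_finrank_eq ?_ ?_
        · rw [Submodule.span_le]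
          rintro x (rfl | rfl) <;> assumption
        · rw [hW2]; exact finrank_span_pair_zmod_two ha hb hab
end

section
/- Let g ≥ 2, let V be a 2g-dimensional 𝔽₂-vector space with a nondegenerate alternating bilinear form ⟨·,·⟩, and fix a nonzero δ ∈ V with orthogonal complement δ^⊥ = {μ ∈ V : ⟨δ,μ⟩ = 0}. Then the number of 2-dimensional subspaces W ⊆ V with W ⊆ δ^⊥, δ ∉ W, and W not isotropic (there exist a, b ∈ W with ⟨a,b⟩ = 1) equals (2^{2g−1} − 2)·2^{2g−2}/6. -/
open Module in
/-- A nonzero linear form on an `(n + 1)`-dimensional `𝔽₂`-space takes the value `1` exactly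
`2 ^ n` times. -/
theorem card_dual_eq_one {U : Type*} [AddCommGroup U] [Module (ZMod 2) U]
    [FiniteDimensional (ZMod 2) U] {n : ℕ} (hn : finrank (ZMod 2) U = n + 1)
    (f : U →ₗ[ZMod 2] ZMod 2) (hf : f ≠ 0) : Nat.card {u // f u = 1} = 2 ^ n := by
  obtain ⟨u₀, hu₀⟩ : ∃ u, f u = 1 := by
    by_contra! h
    exact hf (LinearMap.ext fun u => by
      have : ∀ x : ZMod 2, x ≠ 1 → x = 0 := by decide
      exact this _ (h u))
  have hker : finrank (ZMod 2) (LinearMap.ker f) = n := by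
    have := Dual.finrank_ker_add_one_of_ne_zero (f := f) hf
    omega
  let e : LinearMap.ker f ≃ {u // f u = 1} :=
    (Equiv.addRight u₀).subtypeEquiv fun u => by simp [hu₀]
  rw [← Nat.card_congr e, Module.natCard_eq_pow_finrank (K := ZMod 2), hker, Nat.card_zmod]

open Module in
/-- The number of pairs on which a bilinear form over `𝔽₂` takes the value `1`, in terms of
its left radical. -/
theorem card_bilin_eq_one {U : Type*} [AddCommGroup U] [Module (ZMod 2) U]
    [FiniteDimensional (ZMod 2) U] {n : ℕ} (hn : finrank (ZMod 2) U = n + 1)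
    (B : U →ₗ[ZMod 2] U →ₗ[ZMod 2] ZMod 2) :
    Nat.card {p : U × U // B p.1 p.2 = 1} =
      (2 ^ (n + 1) - Nat.card (LinearMap.ker B)) * 2 ^ n := by
  classical
  have : Finite U := Module.finite_of_finite (ZMod 2)
  have : Fintype U := Fintype.ofFinite U
  have hU : Fintype.card U = 2 ^ (n + 1) := by
    rw [← Nat.card_eq_fintype_card, Module.natCard_eq_pow_finrank (K := ZMod 2), hn,
      Nat.card_zmod]
  let e : {p : U × U // B p.1 p.2 = 1} ≃ Σ a : U, {b // B a b = 1} :=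
    { toFun := fun p => ⟨p.1.1, p.1.2, p.2⟩
      invFun := fun s => ⟨(s.1, s.2.1), s.2.2⟩
      left_inv := fun _ => rfl
      right_inv := fun _ => rfl }
  have hfib (a : U) : Nat.card {b // B a b = 1} = if a ∉ LinearMap.ker B then 2 ^ n else 0 := by
    split_ifs with h
    · have h0 : B a = 0 := h
      simp [h0]
    · exact card_dual_eq_one hn _ h
  have hc : (Finset.univ.filter fun a => a ∉ LinearMap.ker B).card =
      2 ^ (n + 1) - Nat.card (LinearMap.ker B) := by
    rw [← hU, Nat.card_eq_fintype_card, ← Fintype.card_subtype_compl, Fintype.card_subtype]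
  rw [Nat.card_congr e, Nat.card_sigma, Finset.sum_congr rfl fun a _ => hfib a,
    ← Finset.sum_filter, Finset.sum_const, hc, smul_eq_mul]

section Alternating

variable {V : Type*} [AddCommGroup V] [Module (ZMod 2) V]
  {B : V →ₗ[ZMod 2] V →ₗ[ZMod 2] ZMod 2}

/-- The coordinates of a vector in a hyperbolic plane are read off by the form. -/
theorem eq_zero_of_mem_span_pair (halt : ∀ v, B v v = 0) {a b x : V} (hab : B a b = 1)
    (hx : x ∈ Submodule.span (ZMod 2) {a, b}) (ha : B x a = 0) (hb : B x b = 0) : x = 0 := by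
  obtain ⟨s, t, rfl⟩ := Submodule.mem_span_pair.mp hx
  have hba : B b a = -1 := by
    rw [← hab, LinearMap.IsAlt.neg halt]
  simp [halt, hab, hba] at ha hb
  simp [ha, hb]

theorem finrank_span_pair (halt : ∀ v, B v v = 0) {a b : V} (hab : B a b = 1) :
    Module.finrank (ZMod 2) (Submodule.span (ZMod 2) {a, b}) = 2 := by
  have hba : B b a = -1 := by
    rw [← hab, LinearMap.IsAlt.neg halt]
  have hli : LinearIndependent (ZMod 2) ![a, b] := by
    refine LinearIndependent.pair_iff.mpr fun s t h => ?_
    have h1 := congrArg (fun v => B v a) h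
    have h2 := congrArg (fun v => B v b) h
    simp [halt, hab, hba] at h1 h2
    exact ⟨h2, h1⟩
  rw [← Matrix.range_cons_cons_empty a b ![]]
  exact finrank_span_eq_card hli

theorem span_pair_eq [FiniteDimensional (ZMod 2) V] (halt : ∀ v, B v v = 0) {a b : V}
    (hab : B a b = 1) {W : Submodule (ZMod 2) V} (hW : Module.finrank (ZMod 2) W = 2)
    (ha : a ∈ W) (hb : b ∈ W) : Submodule.span (ZMod 2) {a, b} = W :=
  Submodule.eq_of_le_of_finrank_eq
    (Submodule.span_le.mpr (by rintro _ (rfl | rfl) <;> assumption))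
    ((finrank_span_pair halt hab).trans hW.symm)

/-- A non-isotropic plane has six ordered pairs with pairing `1`. -/
theorem card_pairs_of_finrank_eq_two [FiniteDimensional (ZMod 2) V] (halt : ∀ v, B v v = 0)
    {W : Submodule (ZMod 2) V} (hW : Module.finrank (ZMod 2) W = 2)
    (h : ∃ a ∈ W, ∃ b ∈ W, B a b = 1) :
    Nat.card {p : W × W // B p.1 p.2 = 1} = 6 := by
  obtain ⟨a, ha, b, hb, hab⟩ := h
  have hker : LinearMap.ker (B.domRestrict₁₂ W W) = ⊥ := by
    refine (Submodule.eq_bot_iff _).mpr fun x hx => ?_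
    have hx' (y : W) : B x y = 0 := LinearMap.congr_fun (LinearMap.mem_ker.mp hx) y
    exact Subtype.ext (eq_zero_of_mem_span_pair halt hab
      (by rw [span_pair_eq halt hab hW ha hb]; exact x.2) (hx' ⟨a, ha⟩) (hx' ⟨b, hb⟩))
  have := card_bilin_eq_one hW (B.domRestrict₁₂ W W)
  rw [hker] at this
  simp only [Nat.card_unique] at this
  exact this

/-- The radical of `δ^⊥` is `{0, δ}`. -/
theorem card_ker_domRestrict_ker (halt : ∀ v, B v v = 0) (hnd : ∀ v, (∀ w, B v w = 0) → v = 0)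
    {δ : V} (hδ : δ ≠ 0) :
    Nat.card (LinearMap.ker (B.domRestrict₁₂ (LinearMap.ker (B δ)) (LinearMap.ker (B δ)))) =
      2 := by
  set H := LinearMap.ker (B δ)
  obtain ⟨w, hw⟩ : ∃ w, B δ w = 1 := by
    by_contra! h
    refine hδ (hnd δ fun u => ?_)
    have : ∀ x : ZMod 2, x ≠ 1 → x = 0 := by decide
    exact this _ (h u)
  have hδH : δ ∈ H := halt δ
  have hmem (c : ZMod 2) : c • (⟨δ, hδH⟩ : H) ∈ LinearMap.ker (B.domRestrict₁₂ H H) := by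
    refine LinearMap.mem_ker.mpr (LinearMap.ext fun y => ?_)
    have : B δ y = 0 := y.2
    change B (c • δ) y = 0
    simp [this]
  refine (Nat.card_congr (Equiv.ofBijective
    (fun c : ZMod 2 => (⟨c • ⟨δ, hδH⟩, hmem c⟩ : LinearMap.ker (B.domRestrict₁₂ H H)))
    ⟨fun c d hcd => ?_, fun x => ⟨B x.1 w, ?_⟩⟩)).symm.trans (Nat.card_zmod 2)
  · have : c • δ = d • δ := congrArg (fun z => ((z.1 : H) : V)) hcd
    exact smul_left_injective _ hδ this
  · refine Subtype.ext (Subtype.ext (sub_eq_zero.mp (hnd _ fun u => ?_)))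
    have hu : u - B δ u • w ∈ H := by simp [H, hw]
    have h0 : B x.1 (u - B δ u • w) = 0 := LinearMap.congr_fun (LinearMap.mem_ker.mp x.2) ⟨_, hu⟩
    rw [map_sub, map_smul, smul_eq_mul, sub_eq_zero] at h0
    simp [h0, mul_comm]

end Alternating


/-- In a `2g`-dimensional `𝔽₂`-vector space with a nondegenerate alternating
bilinear form and a fixed nonzero `δ`, the number of non-isotropic 2-dimensional subspaces
`W ⊆ δ^⊥` with `δ ∉ W` equals `(2^{2g−1} − 2)·2^{2g−2}/6`. -/
theorem count_nonisotropic_planes_in_perp_avoiding_delta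
    (g : ℕ) (hg : 2 ≤ g) (V : Type*) [AddCommGroup V] [Module (ZMod 2) V]
    [FiniteDimensional (ZMod 2) V] (hdim : Module.finrank (ZMod 2) V = 2 * g)
    (B : V →ₗ[ZMod 2] V →ₗ[ZMod 2] ZMod 2)
    (halt : ∀ v : V, B v v = 0)
    (hnd : ∀ v : V, (∀ w : V, B v w = 0) → v = 0)
    (δ : V) (hδ : δ ≠ 0) :
    Nat.card {W : Submodule (ZMod 2) V //
        Module.finrank (ZMod 2) W = 2 ∧ (∀ μ ∈ W, B δ μ = 0) ∧ δ ∉ W ∧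
          ∃ a ∈ W, ∃ b ∈ W, B a b = 1} =
      (2 ^ (2 * g - 1) - 2) * 2 ^ (2 * g - 2) / 6 := by
  have : Finite V := Module.finite_of_finite (ZMod 2)
  have hBδ : B δ ≠ 0 := fun h => hδ (hnd δ fun w => by simp [h])
  set H := LinearMap.ker (B δ)
  have hrank : Module.finrank (ZMod 2) H = (2 * g - 2) + 1 := by
    have : Module.finrank (ZMod 2) H + 1 = _ :=
      Module.Dual.finrank_ker_add_one_of_ne_zero (f := B δ) hBδ
    omega
  have htotal := card_bilin_eq_one hrank (B.domRestrict₁₂ H H)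
  rw [card_ker_domRestrict_ker halt hnd hδ, show 2 * g - 2 + 1 = 2 * g - 1 by omega] at htotal
  set P := {W : Submodule (ZMod 2) V // Module.finrank (ZMod 2) W = 2 ∧
    (∀ μ ∈ W, B δ μ = 0) ∧ δ ∉ W ∧ ∃ a ∈ W, ∃ b ∈ W, B a b = 1}
  let F : (Σ W : P, {p : W.1 × W.1 // B p.1 p.2 = 1}) →
      {p : H × H // B.domRestrict₁₂ H H p.1 p.2 = 1} := fun s =>
    ⟨(⟨s.2.1.1, s.1.2.2.1 _ s.2.1.1.2⟩, ⟨s.2.1.2, s.1.2.2.1 _ s.2.1.2.2⟩), s.2.2⟩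
  have hF : F.Bijective := by
    constructor
    · rintro ⟨⟨W, hW⟩, ⟨⟨a, ha⟩, ⟨b, hb⟩⟩, hab⟩ ⟨⟨W', hW'⟩, ⟨⟨a', ha'⟩, ⟨b', hb'⟩⟩, hab'⟩ h
      obtain ⟨rfl, rfl⟩ : a = a' ∧ b = b' := 
        ⟨congrArg (fun p => (p.1.1 : V)) h, congrArg (fun p => (p.1.2 : V)) h⟩
      obtain rfl : W = W' := (span_pair_eq halt hab hW.1 ha hb).symm.trans
        (span_pair_eq halt hab' hW'.1 ha' hb')
      rfl
    · rintro ⟨⟨⟨a, ha⟩, ⟨b, hb⟩⟩, hab⟩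
      replace hab : B a b = 1 := hab
      have hle : Submodule.span (ZMod 2) {a, b} ≤ H :=
        Submodule.span_le.mpr (by rintro _ (rfl | rfl) <;> assumption)
      have ha' : a ∈ Submodule.span (ZMod 2) {a, b} := Submodule.subset_span (by simp)
      have hb' : b ∈ Submodule.span (ZMod 2) {a, b} := Submodule.subset_span (by simp)
      exact ⟨⟨⟨Submodule.span (ZMod 2) {a, b}, finrank_span_pair halt hab, fun μ hμ => hle hμ,
        fun h => hδ (eq_zero_of_mem_span_pair halt hab h ha hb), a, ha', b, hb', hab⟩,
        ⟨(⟨a, ha'⟩, ⟨b, hb'⟩), hab⟩⟩, rfl⟩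
  have : Fintype P := Fintype.ofFinite P
  have hcount : Nat.card P * 6 = (2 ^ (2 * g - 1) - 2) * 2 ^ (2 * g - 2) := by
    rw [← htotal, ← Nat.card_congr (Equiv.ofBijective F hF), Nat.card_sigma,
      Finset.sum_congr rfl fun W _ => card_pairs_of_finrank_eq_two halt W.2.1 W.2.2.2.2]
    simp
  rw [← hcount, Nat.mul_div_cancel _ (by norm_num)]
end
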